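/- arXiv:2508.02655 — 5 statements merged into one kernel-verified Lean document; each statement's English description precedes it below -/
import Mathlib

section
/- Let X be a Hausdorff topological space in which every point has a metrizable neighborhood (e.g. a manifold), and let Y ⊆ X be a subset that is paracompact in the subspace topology. Then Y is metrizable, and consequently every subset Z ⊆ Y is paracompact in its subspace topology (Y is hereditarily paracompact). -/
open Set Filter Topology TopologicalSpace
open scoped UniformConvergence

/-- A pseudometrizable subset of a space carries a bounded pseudometric, extended by zero to the
whole space, which determines the neighborhoods of the interior points of the subset. -/
theorem exists_bounded_dist_of_pseudoMetrizableSpace_subtype {X : Type*} [TopologicalSpace X]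
    (s : Set X) [PseudoMetrizableSpace s] :
    ∃ d : X → X → ℝ, (∀ x z, 0 ≤ d x z) ∧ (∀ x z, d x z ≤ 1) ∧
      (∀ x ∈ s, ∀ y ∈ s, ∀ z, |d x z - d y z| ≤ d x y) ∧
      ∀ x ∈ interior s, (𝓝 x).HasBasis (fun ε : ℝ => 0 < ε) fun ε => {y | y ∈ s ∧ d y x < ε} := by
  classical
  let _ := pseudoMetrizableSpacePseudoMetric s
  refine ⟨fun x y => if h : x ∈ s ∧ y ∈ s then min (dist (⟨x, h.1⟩ : s) ⟨y, h.2⟩) 1 else 0,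
    fun x z => ?_, fun x z => ?_, fun x hx y hy z => ?_, fun x hx => ?_⟩
  · dsimp only
    split_ifs <;> positivity
  · dsimp only
    split_ifs
    · exact min_le_right _ _
    · exact zero_le_one
  · by_cases hz : z ∈ s
    · simp only [hx, hy, hz, and_self, dif_pos]
      have h₁ := dist_triangle (⟨x, hx⟩ : s) ⟨y, hy⟩ ⟨z, hz⟩
      have h₂ := dist_triangle_left (⟨y, hy⟩ : s) ⟨z, hz⟩ ⟨x, hx⟩
      have h₃ : 0 ≤ dist (⟨x, hx⟩ : s) ⟨z, hz⟩ := dist_nonneg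
      have h₄ : 0 ≤ dist (⟨y, hy⟩ : s) ⟨z, hz⟩ := dist_nonneg
      rw [abs_le]
      grind
    · simp only [hx, hy, hz, and_true, and_false, dif_neg, dif_pos, not_false_eq_true, sub_self,
        abs_zero]
      positivity
  · have hxs : x ∈ s := interior_subset hx
    refine ⟨fun t => ?_⟩
    have hn : 𝓝 x = map ((↑) : s → X) (𝓝 ⟨x, hxs⟩) := by
      rw [map_nhds_subtype_coe_eq_nhds hxs (mem_interior_iff_mem_nhds.1 hx)]
    rw [hn, mem_map, Metric.mem_nhds_iff]
    constructor
    · rintro ⟨ε, hε, h⟩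
      refine ⟨min ε 1, by positivity, ?_⟩
      rintro y ⟨hy, hyx⟩
      simp only [hy, hxs, and_self, dif_pos] at hyx
      exact @h ⟨y, hy⟩ (Metric.mem_ball.2 (by grind))
    · rintro ⟨ε, hε, h⟩
      refine ⟨ε, hε, fun y hy => h ⟨y.2, ?_⟩⟩
      simp only [y.2, hxs, and_self, dif_pos]
      exact min_lt_of_left_lt hy

/-- A paracompact normal space which is locally pseudometrizable is pseudometrizable. -/
theorem pseudoMetrizableSpace_of_paracompactSpace {X : Type*} [TopologicalSpace X]
    [NormalSpace X] [ParacompactSpace X]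
    (hloc : ∀ x : X, ∃ s ∈ 𝓝 x, PseudoMetrizableSpace s) : PseudoMetrizableSpace X := by
  choose s hs hsm using hloc
  choose d hd0 hd1 hd hbasis using fun i =>
    exists_bounded_dist_of_pseudoMetrizableSpace_subtype (s i)
  obtain ⟨f, hf⟩ := BumpCovering.exists_isSubordinate (isClosed_univ (X := X))
    (fun i => interior (s i)) (fun i => isOpen_interior)
    (fun x _ => mem_iUnion.2 ⟨x, mem_interior_iff_mem_nhds.2 (hs x)⟩)
  let Φ : X → (X × X →ᵤ ℝ × ℝ) := fun x =>
    UniformFun.ofFun fun p => (f p.1 x, f p.1 x * d p.1 x p.2)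
  have hcont : ∀ x₀, ∀ ε > 0, ∀ᶠ x in 𝓝 x₀, ∀ p : X × X,
      |f p.1 x₀ - f p.1 x| < ε ∧ |f p.1 x₀ * d p.1 x₀ p.2 - f p.1 x * d p.1 x p.2| < ε := by
    intro x₀ ε hε
    have hone : ∀ i, ∀ᶠ x in 𝓝 x₀, ∀ z,
        |f i x₀ - f i x| < ε ∧ |f i x₀ * d i x₀ z - f i x * d i x z| < ε := by
      intro i
      by_cases hi : x₀ ∈ tsupport (f i)
      · have hx₀ : x₀ ∈ interior (s i) := hf i hi
        have hx₀s := interior_subset hx₀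
        have hfc := Metric.tendsto_nhds.1 ((f i).continuous.tendsto x₀) (ε / 2) (half_pos hε)
        filter_upwards [hfc, (hbasis i x₀ hx₀).mem_of_mem (half_pos hε)] with x hx ⟨hxs, hdx⟩ z
        rw [Real.dist_eq, abs_sub_comm] at hx
        refine ⟨by linarith, ?_⟩
        have h₁ : |d i x₀ z - d i x z| < ε / 2 := by
          rw [abs_sub_comm]
          exact (hd i x hxs x₀ hx₀s z).trans_lt hdx
        calc |f i x₀ * d i x₀ z - f i x * d i x z|
            = |(f i x₀ - f i x) * d i x₀ z + f i x * (d i x₀ z - d i x z)| := by ring_nf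
          _ ≤ |f i x₀ - f i x| * d i x₀ z + f i x * |d i x₀ z - d i x z| := by
            refine (abs_add_le _ _).trans_eq ?_
            rw [abs_mul, abs_mul, abs_of_nonneg (hd0 i x₀ z), abs_of_nonneg (f.nonneg i x)]
          _ ≤ |f i x₀ - f i x| * 1 + 1 * |d i x₀ z - d i x z| := by
            gcongr
            · exact hd1 i x₀ z
            · exact f.le_one i x
          _ < ε := by linarith
      · filter_upwards [(isClosed_tsupport (f i)).isOpen_compl.mem_nhds hi] with x hx z
        rw [image_eq_zero_of_notMem_tsupport hi, image_eq_zero_of_notMem_tsupport hx]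
        simpa using hε
    obtain ⟨t, ht, hfin⟩ := f.locallyFinite x₀
    filter_upwards [(eventually_all_finite hfin).2 fun i _ => hone i, ht] with x hx hxt p
    by_cases hp : (Function.support (f p.1) ∩ t).Nonempty
    · exact hx p.1 hp p.2
    · have h₀ : ∀ y ∈ t, f p.1 y = 0 := fun y hy => by
        by_contra h
        exact hp ⟨y, h, hy⟩
      rw [h₀ x hxt, h₀ x₀ (mem_of_mem_nhds ht)]
      simpa using hε
  have hsep : ∀ x₀, ∀ W ∈ 𝓝 x₀, ∃ ε > 0, ∀ x, (∀ p : X × X,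
      |f p.1 x₀ - f p.1 x| < ε ∧ |f p.1 x₀ * d p.1 x₀ p.2 - f p.1 x * d p.1 x p.2| < ε) →
      x ∈ W := by
    intro x₀ W hW
    let i := f.ind x₀ (mem_univ x₀)
    have hi : f i x₀ = 1 := f.ind_apply x₀ (mem_univ x₀)
    have hx₀ : x₀ ∈ interior (s i) := hf i (subset_tsupport _ (by simp [hi]))
    obtain ⟨ε, hε, h⟩ := (hbasis i x₀ hx₀).mem_iff.1 hW
    have hd00 : d i x₀ x₀ = 0 := by
      obtain hlt | heq := (hd0 i x₀ x₀).lt_or_eq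
      · exact absurd (mem_of_mem_nhds ((hbasis i x₀ hx₀).mem_of_mem hlt)).2 (lt_irrefl _)
      · exact heq.symm
    refine ⟨min (1 / 2) (ε / 2), by positivity, fun x hx => h ?_⟩
    obtain ⟨h₁, h₂⟩ := hx (i, x₀)
    simp only [hi, hd00] at h₁ h₂
    have h₃ : 1 / 2 < f i x := by
      have := (abs_lt.1 (h₁.trans_le (min_le_left _ _))).2
      linarith
    refine ⟨interior_subset (hf i (subset_tsupport _ ?_)), ?_⟩
    · exact (by linarith : (0 : ℝ) < f i x).ne'
    · have h₄ := (abs_lt.1 (h₂.trans_le (min_le_right _ _))).1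
      nlinarith [hd0 i x x₀]
  have hΦ : IsInducing Φ := by
    refine isInducing_iff_nhds.2 fun x₀ => ?_
    have hb := (UniformFun.hasBasis_nhds_of_basis (X × X) (ℝ × ℝ) (Φ x₀)
      (Metric.uniformity_basis_dist (α := ℝ × ℝ))).comap Φ
    have hmem : ∀ ε x, x ∈ Φ ⁻¹' {g | (Φ x₀, g) ∈ UniformFun.gen (X × X) (ℝ × ℝ)
        {p : (ℝ × ℝ) × ℝ × ℝ | dist p.1 p.2 < ε}} ↔ ∀ p : X × X,
        |f p.1 x₀ - f p.1 x| < ε ∧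
          |f p.1 x₀ * d p.1 x₀ p.2 - f p.1 x * d p.1 x p.2| < ε := by
      intro ε x
      simp [UniformFun.gen, Φ, Prod.dist_eq, Real.dist_eq]
    ext W
    rw [hb.mem_iff]
    constructor
    · intro hW
      obtain ⟨ε, hε, h⟩ := hsep x₀ W hW
      exact ⟨ε, hε, fun x hx => h x ((hmem ε x).1 hx)⟩
    · rintro ⟨ε, hε, h⟩
      filter_upwards [hcont x₀ ε hε] with x hx
      exact h ((hmem ε x).2 hx)
  have : IsCountablyGenerated (uniformity (X × X →ᵤ ℝ × ℝ)) :=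
    (UniformFun.hasBasis_uniformity_of_basis (X × X) (ℝ × ℝ)
      Metric.uniformity_basis_dist_inv_nat_succ).isCountablyGenerated
  exact hΦ.pseudoMetrizableSpace

/-- Let `X` be a Hausdorff space in which every point has a metrizable
neighborhood (e.g. a manifold). Then every paracompact subset `Y ⊆ X` is
metrizable, and consequently every subset `Z ⊆ Y` is paracompact in its
subspace topology, i.e. `Y` is hereditarily paracompact. -/
theorem paracompact_subset_of_locallyMetrizable_metrizable
    (X : Type*) [TopologicalSpace X] [T2Space X]
    (hloc : ∀ x : X, ∃ s ∈ nhds x, TopologicalSpace.MetrizableSpace s)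
    (Y : Set X) (hY : ParacompactSpace Y) :
    TopologicalSpace.MetrizableSpace Y ∧
      ∀ Z : Set X, Z ⊆ Y → ParacompactSpace Z := by
  have hmetr : MetrizableSpace Y := by
    have : PseudoMetrizableSpace Y := by
      refine pseudoMetrizableSpace_of_paracompactSpace fun y => ?_
      obtain ⟨s, hs, hsm⟩ := hloc y
      refine ⟨(↑) ⁻¹' s, continuous_subtype_val.continuousAt.preimage_mem_nhds hs, ?_⟩
      have hind : IsInducing (s.restrictPreimage ((↑) : Y → X)) :=
        IsInducing.subtypeVal.restrictPreimage s
      exact hind.pseudoMetrizableSpace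
    infer_instance
  refine ⟨hmetr, fun Z hZ => ?_⟩
  have : MetrizableSpace Z := (IsEmbedding.inclusion hZ).metrizableSpace
  let _ := metrizableSpaceMetric Z
  infer_instance
end

section
/- If a Hausdorff topological space X is the union of finitely many closed subsets, each of which is paracompact in the subspace topology, then X is paracompact. -/
open Set Topology

/-- A locally finite family of subsets of a closed subspace is locally finite in the ambient
space. -/
theorem LocallyFinite.image_subtype_val {X α : Type*} [TopologicalSpace X] {s : Set X}
    (hs : IsClosed s) {f : α → Set s} (hf : LocallyFinite f) :
    LocallyFinite fun a => ((↑) '' f a : Set X) := by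
  intro x
  by_cases hx : x ∈ s
  · obtain ⟨t, ht, hfin⟩ := hf ⟨x, hx⟩
    obtain ⟨u, hu, hut⟩ := (mem_nhds_subtype s ⟨x, hx⟩ t).1 ht
    refine ⟨u, hu, hfin.subset ?_⟩
    rintro a ⟨_, ⟨y, hy, rfl⟩, hyu⟩
    exact ⟨y, hy, hut hyu⟩
  · refine ⟨sᶜ, hs.isOpen_compl.mem_nhds hx, finite_empty.subset ?_⟩
    rintro a ⟨_, ⟨y, -, rfl⟩, hys⟩
    exact hys y.2

/-- The indexwise union of finitely many locally finite families is locally finite. -/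
theorem LocallyFinite.iUnion_of_finite {X α ι : Type*} [TopologicalSpace X] [Finite ι]
    {f : ι → α → Set X} (hf : ∀ i, LocallyFinite (f i)) :
    LocallyFinite fun a => ⋃ i, f i a := by
  intro x
  choose t ht hfin using fun i => hf i x
  refine ⟨⋂ i, t i, Filter.iInter_mem.2 ht, (finite_iUnion hfin).subset ?_⟩
  rintro a ⟨y, hy, hyt⟩
  obtain ⟨i, hi⟩ := mem_iUnion.1 hy
  exact mem_iUnion.2 ⟨i, y, hi, mem_iInter.1 hyt i⟩

/-- One of Michael's theorems: a space in which every open cover has a precise locally finite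
closed refinement is paracompact. -/
theorem ParacompactSpace.of_closed_refinement.{v} {X : Type v} [TopologicalSpace X]
    (h : ∀ {α : Type v} (u : α → Set X), (∀ a, IsOpen (u a)) → ⋃ a, u a = univ →
      ∃ f : α → Set X, (∀ a, IsClosed (f a)) ∧ ⋃ a, f a = univ ∧ LocallyFinite f ∧
        ∀ a, f a ⊆ u a) : ParacompactSpace X where
  locallyFinite_refinement α u ho hu := by
    obtain ⟨f, -, hf, hfl, hfu⟩ := h u ho hu
    choose t ht hfin using hfl
    obtain ⟨c, hcc, hc, hcl, hct⟩ := h (fun x => interior (t x)) (fun _ => isOpen_interior)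
      (iUnion_eq_univ_iff.2 fun x => ⟨x, mem_interior_iff_mem_nhds.2 (ht x)⟩)
    let w (a : α) : Set X := (⋃ x : {x // Disjoint (c x) (f a)}, c x)ᶜ
    have hw (a : α) : IsOpen (w a) :=
      ((hcl.comp_injective Subtype.val_injective).isClosed_iUnion fun x => hcc x.1).isOpen_compl
    have hfw (a : α) : f a ⊆ w a := by
      intro y hy hyc
      obtain ⟨x, hx⟩ := mem_iUnion.1 hyc
      exact disjoint_left.1 x.2 hx hy
    have hwl : LocallyFinite w := by
      intro x
      obtain ⟨n, hn, hnfin⟩ := hcl x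
      refine ⟨n, hn, (hnfin.biUnion fun z _ => hfin z).subset ?_⟩
      rintro a ⟨y, hyw, hyn⟩
      obtain ⟨z, hz⟩ := iUnion_eq_univ_iff.1 hc y
      have hd : ¬ Disjoint (c z) (f a) := fun hd => hyw (mem_iUnion.2 ⟨⟨z, hd⟩, hz⟩)
      obtain ⟨p, hpc, hpf⟩ := not_disjoint_iff.1 hd
      exact mem_biUnion (show z ∈ {z | (c z ∩ n).Nonempty} from ⟨y, hz, hyn⟩)
        ⟨p, hpf, interior_subset (hct z hpc)⟩
    refine ⟨α, fun a => w a ∩ u a, fun a => (hw a).inter (ho a), ?_,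
      hwl.subset fun a => inter_subset_left, fun a => ⟨a, inter_subset_right⟩⟩
    refine iUnion_eq_univ_iff.2 fun x => ?_
    obtain ⟨a, ha⟩ := iUnion_eq_univ_iff.1 hf x
    exact ⟨a, hfw a ha, hfu a ha⟩

/-- Every open cover of a paracompact Hausdorff space has a precise locally finite closed
refinement. -/
theorem precise_closed_refinement {X α : Type*} [TopologicalSpace X] [T2Space X]
    [ParacompactSpace X] (u : α → Set X) (uo : ∀ a, IsOpen (u a)) (uc : ⋃ a, u a = univ) :
    ∃ f : α → Set X, (∀ a, IsClosed (f a)) ∧ ⋃ a, f a = univ ∧ LocallyFinite f ∧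
      ∀ a, f a ⊆ u a := by
  obtain ⟨v, hvo, hv, hvl, hvu⟩ := precise_refinement u uo uc
  obtain ⟨f, hf, hfc, hfv⟩ := exists_iUnion_eq_closed_subset hvo hvl.point_finite hv
  exact ⟨f, hfc, hf, hvl.subset hfv, fun a => (hfv a).trans (hvu a)⟩

/-- If a Hausdorff topological space `X` is the union of finitely many closed
subsets, each of which is paracompact in the subspace topology, then `X` is
paracompact. -/
theorem paracompact_of_finite_union_closed_paracompact
    (X : Type*) [TopologicalSpace X] [T2Space X]
    (ι : Type*) [Finite ι] (s : ι → Set X)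
    (hclosed : ∀ i, IsClosed (s i))
    (hpara : ∀ i, ParacompactSpace (s i))
    (hcover : ⋃ i, s i = Set.univ) :
    ParacompactSpace X := by
  refine ParacompactSpace.of_closed_refinement fun {α} u uo uc => ?_
  have key (i : ι) := precise_closed_refinement (fun a => ((↑) ⁻¹' u a : Set (s i)))
    (fun a => (uo a).preimage continuous_subtype_val) (by rw [← preimage_iUnion, uc, preimage_univ])
  choose f hfc hf hfl hfu using key
  refine ⟨fun a => ⋃ i, (↑) '' f i a,
    fun a => isClosed_iUnion_of_finite fun i => (hclosed i).isClosedMap_subtype_val _ (hfc i a), ?_,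
    LocallyFinite.iUnion_of_finite fun i => (hfl i).image_subtype_val (hclosed i),
    fun a => iUnion_subset fun i => image_subset_iff.2 (hfu i a)⟩
  refine iUnion_eq_univ_iff.2 fun x => ?_
  obtain ⟨i, hi⟩ := iUnion_eq_univ_iff.1 hcover x
  obtain ⟨a, ha⟩ := iUnion_eq_univ_iff.1 (hf i) ⟨x, hi⟩
  exact ⟨a, mem_iUnion.2 ⟨i, ⟨x, hi⟩, ha, rfl⟩⟩
end

section
/- A manifold is paracompact if and only if every connected component of it is second countable. -/
open Set Topology TopologicalSpace

/-- A connected paracompact weakly locally compact space is `σ`-compact. -/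
theorem sigmaCompactSpace_of_connected_paracompact (X : Type*) [TopologicalSpace X]
    [ConnectedSpace X] [ParacompactSpace X] [WeaklyLocallyCompactSpace X] :
    SigmaCompactSpace X := by
  choose K hK hKx using fun x : X => exists_compact_mem_nhds x
  obtain ⟨V, hVo, hVcover, hVfin, hVK⟩ := precise_refinement (fun x => interior (K x))
    (fun _ => isOpen_interior)
    (iUnion_eq_univ_iff.2 fun x => ⟨x, mem_interior_iff_mem_nhds.2 (hKx x)⟩)
  have mem_V (x : X) : ∃ a, x ∈ V a := iUnion_eq_univ_iff.1 hVcover x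
  have enlarge (L : Set X) (hL : IsCompact L) :
      ∃ L', IsCompact L' ∧ ∀ a, (V a ∩ L).Nonempty → V a ⊆ L' :=
    ⟨⋃ a ∈ {a | (V a ∩ L).Nonempty}, K a,
      (hVfin.finite_nonempty_inter_compact hL).isCompact_biUnion fun a _ => hK a,
      fun a ha => ((hVK a).trans interior_subset).trans
        (subset_biUnion_of_mem (u := K) (show a ∈ {a | (V a ∩ L).Nonempty} from ha))⟩
  choose! E hE hVE using enlarge
  obtain ⟨x₀⟩ : Nonempty X := inferInstance
  let L : ℕ → Set X := fun n => E^[n] {x₀}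
  have L_succ (n : ℕ) : L (n + 1) = E (L n) := Function.iterate_succ_apply' E n {x₀}
  have hL (n : ℕ) : IsCompact (L n) := by
    induction n with
    | zero => exact isCompact_singleton
    | succ n ih => rw [L_succ]; exact hE _ ih
  have absorb (a : X) (h : (V a ∩ ⋃ n, L n).Nonempty) : V a ⊆ ⋃ n, L n := by
    obtain ⟨x, hxa, hx⟩ := h
    obtain ⟨n, hn⟩ := mem_iUnion.1 hx
    have := hVE (L n) (hL n) a ⟨x, hxa, hn⟩
    rw [← L_succ] at this
    exact this.trans (subset_iUnion L (n + 1))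
  have hclopen : IsClopen (⋃ n, L n) := by
    refine ⟨isClosed_of_closure_subset fun x hx => ?_, isOpen_iff_mem_nhds.2 fun x hx => ?_⟩
    · obtain ⟨a, ha⟩ := mem_V x
      exact absorb a (mem_closure_iff.1 hx (V a) (hVo a) ha) ha
    · obtain ⟨a, ha⟩ := mem_V x
      exact Filter.mem_of_superset ((hVo a).mem_nhds ha) (absorb a ⟨x, ha, hx⟩)
  exact ⟨⟨L, hL, hclopen.eq_univ ⟨x₀, mem_iUnion.2 ⟨0, rfl⟩⟩⟩⟩

/-- A space mapping continuously to a discrete space with paracompact fibers is paracompact. -/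
theorem ParacompactSpace.of_fibers {X : Type*} {ι : Type*} [TopologicalSpace X]
    [TopologicalSpace ι] [DiscreteTopology ι] {f : X → ι} (hf : Continuous f)
    (h : ∀ i, ParacompactSpace (f ⁻¹' {i})) : ParacompactSpace X := by
  have emb (i : ι) : IsOpenEmbedding (Subtype.val : f ⁻¹' {i} → X) :=
    ((isOpen_discrete {i}).preimage hf).isOpenEmbedding_subtypeVal
  refine ⟨fun α s ho hc => ?_⟩
  have refine_fiber (i : ι) := precise_refinement (fun a => (Subtype.val ⁻¹' s a : Set (f ⁻¹' {i})))
    (fun a => (ho a).preimage continuous_subtype_val)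
    (by rw [← preimage_iUnion, hc, preimage_univ])
  choose v hvo hvc hvf hvs using refine_fiber
  refine ⟨α, fun a => ⋃ i, Subtype.val '' v i a, fun a => isOpen_iUnion fun i =>
    (emb i).isOpenMap _ (hvo i a), ?_, fun x => ?_, fun a => ⟨a, ?_⟩⟩
  · refine iUnion_eq_univ_iff.2 fun x => ?_
    obtain ⟨a, ha⟩ := iUnion_eq_univ_iff.1 (hvc (f x)) ⟨x, rfl⟩
    exact ⟨a, mem_iUnion.2 ⟨f x, ⟨x, rfl⟩, ha, rfl⟩⟩
  · obtain ⟨t, ht, hfin⟩ := hvf (f x) ⟨x, rfl⟩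
    refine ⟨Subtype.val '' t, (emb (f x)).isOpenMap.image_mem_nhds ht, hfin.subset ?_⟩
    rintro a ⟨_, hy, z, hz, rfl⟩
    obtain ⟨i, w, hw, hwz⟩ := mem_iUnion.1 hy
    obtain rfl : f x = i := by rw [← show f z = f x from z.2, ← hwz]; exact w.2
    obtain rfl := Subtype.val_injective hwz
    exact ⟨w, hw, hz⟩
  · rintro _ hy
    obtain ⟨i, w, hw, rfl⟩ := mem_iUnion.1 hy
    exact hvs i a hw

/-- A manifold (a Hausdorff space locally homeomorphic to `ℝⁿ`, with no
countability assumption) is paracompact if and only if every connected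
component of it is second countable. -/
theorem manifold_paracompact_iff_components_secondCountable
    (n : ℕ) (M : Type*) [TopologicalSpace M] [T2Space M]
    [ChartedSpace (EuclideanSpace ℝ (Fin n)) M] :
    ParacompactSpace M ↔
      ∀ x : M, SecondCountableTopology (connectedComponent x) := by
  have : LocallyConnectedSpace M := ChartedSpace.locallyConnectedSpace (EuclideanSpace ℝ (Fin n)) M
  have : LocallyCompactSpace M := ChartedSpace.locallyCompactSpace (EuclideanSpace ℝ (Fin n)) M
  have hloc (x : M) : LocallyCompactSpace (connectedComponent x) :=
    isClosed_connectedComponent.isClosedEmbedding_subtypeVal.locallyCompactSpace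
  constructor
  · intro _ x
    have : ParacompactSpace (connectedComponent x) :=
      isClosed_connectedComponent.isClosedEmbedding_subtypeVal.paracompactSpace
    have : ConnectedSpace (connectedComponent x) :=
      isConnected_iff_connectedSpace.1 isConnected_connectedComponent
    have := sigmaCompactSpace_of_connected_paracompact (connectedComponent x)
    let U : Opens M := ⟨connectedComponent x, isOpen_connectedComponent⟩
    have : SigmaCompactSpace U := this
    exact ChartedSpace.secondCountable_of_sigmaCompact (EuclideanSpace ℝ (Fin n)) U
  · intro h
    refine ParacompactSpace.of_fibers (ConnectedComponents.continuous_coe (α := M)) fun i => ?_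
    obtain ⟨x, rfl⟩ := ConnectedComponents.surjective_coe i
    rw [connectedComponents_preimage_singleton]
    infer_instance
end

section
/- Every compact subset K of a connected manifold M is contained in an open connected subset N ⊆ M whose closure in M is compact (in particular N is a paracompact open connected submanifold containing K). -/
open Set Topology

/-- In a Hausdorff, locally compact and locally connected space, every point has an open connected
neighbourhood with compact closure. -/
theorem exists_isOpen_isConnected_mem_isCompact_closure {X : Type*} [TopologicalSpace X]
    [T2Space X] [LocallyCompactSpace X] [LocallyConnectedSpace X] (x : X) :
    ∃ U : Set X, IsOpen U ∧ IsConnected U ∧ x ∈ U ∧ IsCompact (closure U) := by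
  obtain ⟨C, hC, hxC⟩ := exists_compact_mem_nhds x
  obtain ⟨U, hUC, hU, hxU, hUconn⟩ :=
    locallyConnectedSpace_iff_subsets_isOpen_isConnected.1 inferInstance x C hxC
  exact ⟨U, hU, hUconn, hxU, hC.closure_of_subset hUC⟩

/-- The union of two intersecting open connected sets with compact closures is again such a set. -/
theorem isOpen_isConnected_isCompact_closure_union {X : Type*} [TopologicalSpace X]
    {U V : Set X} (hU : IsOpen U ∧ IsConnected U ∧ IsCompact (closure U))
    (hV : IsOpen V ∧ IsConnected V ∧ IsCompact (closure V)) (hUV : (U ∩ V).Nonempty) :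
    IsOpen (U ∪ V) ∧ IsConnected (U ∪ V) ∧ IsCompact (closure (U ∪ V)) :=
  ⟨hU.1.union hV.1, hU.2.1.union hUV hV.2.1, by
    rw [closure_union]
    exact hU.2.2.union hV.2.2⟩

/-- In a connected, locally compact and locally connected Hausdorff space, any two points lie in
a common open connected set with compact closure. -/
theorem exists_isOpen_isConnected_isCompact_closure_mem_mem {X : Type*} [TopologicalSpace X]
    [T2Space X] [LocallyCompactSpace X] [LocallyConnectedSpace X] [PreconnectedSpace X]
    (a b : X) :
    ∃ U : Set X, (IsOpen U ∧ IsConnected U ∧ IsCompact (closure U)) ∧ a ∈ U ∧ b ∈ U := by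
  let S : Set X :=
    {y | ∃ U : Set X, (IsOpen U ∧ IsConnected U ∧ IsCompact (closure U)) ∧ a ∈ U ∧ y ∈ U}
  have hopen : IsOpen S := isOpen_iff_mem_nhds.2 fun y ⟨U, hU, haU, hyU⟩ =>
    Filter.mem_of_superset (hU.1.mem_nhds hyU) fun _ hz => ⟨U, hU, haU, hz⟩
  have hclosed : IsClosed S := isClosed_of_closure_subset fun y hy => by
    obtain ⟨V, hV, hVconn, hyV, hVc⟩ := exists_isOpen_isConnected_mem_isCompact_closure y
    obtain ⟨z, hzV, U, hU, haU, hzU⟩ := mem_closure_iff.1 hy V hV hyV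
    exact ⟨U ∪ V, isOpen_isConnected_isCompact_closure_union hU ⟨hV, hVconn, hVc⟩ ⟨z, hzU, hzV⟩,
      Or.inl haU, Or.inr hyV⟩
  obtain ⟨V, hV, hVconn, haV, hVc⟩ := exists_isOpen_isConnected_mem_isCompact_closure a
  have huniv : S = univ :=
    IsClopen.eq_univ ⟨hclosed, hopen⟩ ⟨a, V, ⟨hV, hVconn, hVc⟩, haV, haV⟩
  exact eq_univ_iff_forall.1 huniv b

/-- A compact subset of a connected, locally compact and locally connected Hausdorff space is
contained in an open connected set with compact closure. -/
theorem IsCompact.exists_isOpen_isConnected_superset_isCompact_closure {X : Type*}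
    [TopologicalSpace X] [T2Space X] [LocallyCompactSpace X] [LocallyConnectedSpace X]
    [ConnectedSpace X] {K : Set X} (hK : IsCompact K) :
    ∃ U : Set X, (IsOpen U ∧ IsConnected U ∧ IsCompact (closure U)) ∧ K ⊆ U := by
  obtain ⟨a⟩ := (inferInstance : Nonempty X)
  suffices h : ∃ U : Set X, (IsOpen U ∧ IsConnected U ∧ IsCompact (closure U)) ∧ a ∈ U ∧ K ⊆ U by
    obtain ⟨U, hU, -, hKU⟩ := h
    exact ⟨U, hU, hKU⟩
  refine hK.induction_on
    (p := fun s => ∃ U : Set X, (IsOpen U ∧ IsConnected U ∧ IsCompact (closure U)) ∧ a ∈ U ∧ s ⊆ U)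
    ?_ ?_ ?_ ?_
  · obtain ⟨U, hU, haU, -⟩ := exists_isOpen_isConnected_isCompact_closure_mem_mem a a
    exact ⟨U, hU, haU, empty_subset U⟩
  · rintro s t hst ⟨U, hU, haU, htU⟩
    exact ⟨U, hU, haU, hst.trans htU⟩
  · rintro s t ⟨U, hU, haU, hsU⟩ ⟨V, hV, haV, htV⟩
    exact ⟨U ∪ V, isOpen_isConnected_isCompact_closure_union hU hV ⟨a, haU, haV⟩, Or.inl haU,
      union_subset_union hsU htV⟩
  · intro x _
    obtain ⟨U, hU, haU, hxU⟩ := exists_isOpen_isConnected_isCompact_closure_mem_mem a x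
    exact ⟨U, mem_nhdsWithin_of_mem_nhds (hU.1.mem_nhds hxU), U, hU, haU, Subset.rfl⟩

/-- A subset of a compact set in a space with second countable charts is second countable. -/
theorem ChartedSpace.secondCountableTopology_of_subset_isCompact (H : Type*) {M : Type*}
    [TopologicalSpace H] [SecondCountableTopology H] [TopologicalSpace M] [ChartedSpace H M]
    {s C : Set M} (hC : IsCompact C) (hs : s ⊆ C) : SecondCountableTopology s := by
  obtain ⟨t, ht⟩ := hC.elim_finite_subcover (fun x : M => (chartAt H x).source)
    (fun x => (chartAt H x).open_source) fun x _ => mem_iUnion.2 ⟨x, mem_chart_source H x⟩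
  let U : t → Set s := fun x => Subtype.val ⁻¹' (chartAt H (x : M)).source
  have (x : t) : SecondCountableTopology (U x) := by
    have := (chartAt H (x : M)).secondCountableTopology_source
    have hval : IsInducing fun y : U x => (y : M) := IsInducing.subtypeVal.comp .subtypeVal
    have hi : IsInducing fun y : U x => (⟨y.1.1, y.2⟩ : (chartAt H (x : M)).source) :=
      .of_comp (g := Subtype.val) (by fun_prop) continuous_subtype_val hval
    exact hi.secondCountableTopology
  refine TopologicalSpace.secondCountableTopology_of_countable_cover (U := U)
    (fun x => (chartAt H (x : M)).open_source.preimage continuous_subtype_val)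
    (eq_univ_of_forall fun y => ?_)
  obtain ⟨x, hx, hy⟩ := mem_iUnion₂.1 (ht (hs y.2))
  exact mem_iUnion.2 ⟨⟨x, hx⟩, hy⟩

/-- Every compact subset `K` of a connected manifold `M` is contained in an
open connected subset `N ⊆ M` whose closure in `M` is compact; in particular
`N` is a paracompact open connected submanifold containing `K`. -/
theorem compact_subset_mem_open_connected_relatively_compact
    (n : ℕ) (M : Type*) [TopologicalSpace M] [T2Space M]
    [ChartedSpace (EuclideanSpace ℝ (Fin n)) M] [ConnectedSpace M]
    (K : Set M) (hK : IsCompact K) :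
    ∃ N : Set M, IsOpen N ∧ IsConnected N ∧ K ⊆ N ∧
      IsCompact (closure N) ∧ ParacompactSpace N := by
  have := ChartedSpace.locallyCompactSpace (EuclideanSpace ℝ (Fin n)) M
  have := ChartedSpace.locallyConnectedSpace (EuclideanSpace ℝ (Fin n)) M
  obtain ⟨N, ⟨hN, hNconn, hNc⟩, hKN⟩ := hK.exists_isOpen_isConnected_superset_isCompact_closure
  have := ChartedSpace.secondCountableTopology_of_subset_isCompact (EuclideanSpace ℝ (Fin n))
    hNc subset_closure
  have := hN.locallyCompactSpace
  exact ⟨N, hN, hNconn, hKN, hNc, inferInstance⟩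
end

section
/- Let M be a connected manifold and let K_i ⊆ M, i ∈ ℕ, be a countable collection of compact subsets. Then the union ⋃_i K_i is contained in an open connected subset N ⊆ M which is paracompact in the subspace topology. -/
open Set Topology in
/-- In a connected, locally connected, weakly locally compact space, every compact set lies in an
open connected set which contains a given point and is contained in a compact set. -/
theorem IsCompact.exists_isOpen_isConnected_superset {X : Type*} [TopologicalSpace X]
    [WeaklyLocallyCompactSpace X] [LocallyConnectedSpace X] [ConnectedSpace X] (x : X)
    {L : Set X} (hL : IsCompact L) :
    ∃ V C : Set X, IsOpen V ∧ IsConnected V ∧ x ∈ V ∧ L ⊆ V ∧ V ⊆ C ∧ IsCompact C := by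
  have hnhds (y : X) : ∃ W C : Set X, IsOpen W ∧ IsConnected W ∧ y ∈ W ∧ W ⊆ C ∧
      IsCompact C := by
    obtain ⟨C, hC, hy⟩ := exists_compact_mem_nhds y
    obtain ⟨W, ⟨hWo, hyW, hWc⟩, hWC⟩ :=
      (LocallyConnectedSpace.open_connected_basis y).mem_iff.1 hy
    exact ⟨W, C, hWo, hWc, hyW, hWC, hC⟩
  let A : Set X := {y | ∃ V C : Set X, IsOpen V ∧ IsConnected V ∧ x ∈ V ∧ y ∈ V ∧ V ⊆ C ∧
    IsCompact C}
  have hAo : IsOpen A := by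
    rw [isOpen_iff_mem_nhds]
    rintro y ⟨V, C, hV, hVc, hx, hy, hVC, hC⟩
    exact Filter.mem_of_superset (hV.mem_nhds hy) fun z hz ↦ ⟨V, C, hV, hVc, hx, hz, hVC, hC⟩
  have hAc : IsClosed A := by
    refine isClosed_of_closure_subset fun y hy ↦ ?_
    obtain ⟨W, D, hW, hWc, hyW, hWD, hD⟩ := hnhds y
    obtain ⟨z, hzW, V, C, hV, hVc, hx, hz, hVC, hC⟩ := mem_closure_iff.1 hy W hW hyW
    exact ⟨V ∪ W, C ∪ D, hV.union hW, hVc.union ⟨z, hz, hzW⟩ hWc, .inl hx, .inr hyW,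
      union_subset_union hVC hWD, hC.union hD⟩
  have hA : A = univ := by
    obtain ⟨W, D, hW, hWc, hxW, hWD, hD⟩ := hnhds x
    exact IsClopen.eq_univ ⟨hAc, hAo⟩ ⟨x, W, D, hW, hWc, hxW, hxW, hWD, hD⟩
  refine hL.induction_on ?_ (fun s t hst ht ↦ ?_) (fun s t hs ht ↦ ?_) fun y _ ↦ ?_
  · obtain ⟨W, D, hW, hWc, hxW, hWD, hD⟩ := hnhds x
    exact ⟨W, D, hW, hWc, hxW, empty_subset _, hWD, hD⟩
  · obtain ⟨V, C, hV, hVc, hx, htV, hVC, hC⟩ := ht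
    exact ⟨V, C, hV, hVc, hx, hst.trans htV, hVC, hC⟩
  · obtain ⟨V, C, hV, hVc, hx, hsV, hVC, hC⟩ := hs
    obtain ⟨W, D, hW, hWc, hxW, htW, hWD, hD⟩ := ht
    exact ⟨V ∪ W, C ∪ D, hV.union hW, hVc.union ⟨x, hx, hxW⟩ hWc, .inl hx,
      union_subset_union hsV htW, union_subset_union hVC hWD, hC.union hD⟩
  · obtain ⟨V, C, hV, hVc, hx, hy, hVC, hC⟩ : y ∈ A := hA ▸ mem_univ y
    exact ⟨V, mem_nhdsWithin_of_mem_nhds (hV.mem_nhds hy), V, C, hV, hVc, hx, Subset.rfl, hVC, hC⟩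

open Set in
/-- In a connected, locally connected, weakly locally compact space, every countable union of
compact sets lies in an open connected σ-compact set. -/
theorem exists_isOpen_isConnected_isSigmaCompact_superset {X : Type*} [TopologicalSpace X]
    [WeaklyLocallyCompactSpace X] [LocallyConnectedSpace X] [ConnectedSpace X]
    (K : ℕ → Set X) (hK : ∀ i, IsCompact (K i)) :
    ∃ N : Set X, IsOpen N ∧ IsConnected N ∧ (⋃ i, K i) ⊆ N ∧ IsSigmaCompact N := by
  obtain ⟨x⟩ : Nonempty X := inferInstance
  choose V C hV hVc hx hLV hVC hC using fun L : {L : Set X // IsCompact L} ↦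
    L.2.exists_isOpen_isConnected_superset x
  let L : ℕ → {L : Set X // IsCompact L} := fun k ↦
    Nat.rec ⟨K 0, hK 0⟩ (fun k L ↦ ⟨C L ∪ K (k + 1), (hC L).union (hK (k + 1))⟩) k
  have hCV (k : ℕ) : C (L k) ⊆ V (L (k + 1)) := subset_union_left.trans (hLV (L (k + 1)))
  have hKV (k : ℕ) : K k ⊆ V (L k) := by
    cases k with
    | zero => exact hLV (L 0)
    | succ k => exact subset_union_right.trans (hLV (L (k + 1)))
  refine ⟨⋃ k, V (L k), isOpen_iUnion fun k ↦ hV _, ⟨⟨x, mem_iUnion.2 ⟨0, hx _⟩⟩, ?_⟩,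
    iUnion_mono hKV, fun k ↦ C (L k), fun k ↦ hC _, ?_⟩
  · exact isPreconnected_iUnion ⟨x, mem_iInter.2 fun k ↦ hx _⟩ fun k ↦ (hVc _).isPreconnected
  · exact (iUnion_subset fun k ↦ (hCV k).trans (subset_iUnion (fun k ↦ V (L k)) (k + 1))).antisymm
      (iUnion_mono fun k ↦ hVC _)

/-- Let `M` be a connected manifold and `K i ⊆ M`, `i ∈ ℕ`, a countable
collection of compact subsets. Then `⋃ i, K i` is contained in an open
connected subset `N ⊆ M` which is paracompact in the subspace topology. -/
theorem countable_union_compacts_subset_open_connected_paracompact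
    (n : ℕ) (M : Type*) [TopologicalSpace M] [T2Space M]
    [ChartedSpace (EuclideanSpace ℝ (Fin n)) M] [ConnectedSpace M]
    (K : ℕ → Set M) (hK : ∀ i, IsCompact (K i)) :
    ∃ N : Set M, IsOpen N ∧ IsConnected N ∧ (⋃ i, K i) ⊆ N ∧
      ParacompactSpace N := by
  have := ChartedSpace.locallyCompactSpace (EuclideanSpace ℝ (Fin n)) M
  have := ChartedSpace.locallyConnectedSpace (EuclideanSpace ℝ (Fin n)) M
  obtain ⟨N, hNo, hNc, hKN, hN⟩ := exists_isOpen_isConnected_isSigmaCompact_superset K hK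
  have := isSigmaCompact_iff_sigmaCompactSpace.1 hN
  have := hNo.locallyCompactSpace
  exact ⟨N, hNo, hNc, hKN, inferInstance⟩
end
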